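/- Let 0 < δ < 1/2, λ > 0, and let Ω ⊂ ℝ² be a set of finite perimeter. For α > 1 set Ω̃ = α⁻¹ Ω. Then α E_{λ,δ}(Ω̃) − E_{λ,δ}(Ω) ≤ (λ log α / |log δ|) · P(Ω), where E_{λ,δ}(Ω) = P(Ω) − (λ/(4|log δ|)) ∫∫ |χ_Ω(x+z) − χ_Ω(x)|² g_δ(|z|)/|z|³ dz dx. -/

import Mathlib

open MeasureTheory Real Filter Set

noncomputable section

/-- The plane `ℝ²`. -/
abbrev Plane := EuclideanSpace ℝ (Fin 2)

/-- Divergence of a vector field on the plane. -/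
def divg (φ : Plane → Plane) (x : Plane) : ℝ :=
  ∑ i : Fin 2, fderiv ℝ φ x (EuclideanSpace.single i 1) i

/-- The set of values `∫_Ω div φ` over admissible test vector fields. -/
def perimVals (Ω : Set Plane) : Set ℝ :=
  {s | ∃ φ : Plane → Plane, ContDiff ℝ 1 φ ∧ HasCompactSupport φ ∧
        (∀ x, ‖φ x‖ ≤ 1) ∧ s = ∫ x in Ω, divg φ x}

/-- The De Giorgi perimeter of a set in the plane. -/
def perim (Ω : Set Plane) : ℝ := sSup (perimVals Ω)

/-- A set has finite perimeter if the defining supremum is finite. -/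
def HasFinPer (Ω : Set Plane) : Prop := BddAbove (perimVals Ω)

/-- The cutoff function `g_δ(r) = χ_{(δ,∞)}(r)`. -/
def gdel (δ r : ℝ) : ℝ := if δ < r then 1 else 0

/-- Characteristic function of a set. -/
def ind (Ω : Set Plane) : Plane → ℝ := Set.indicator Ω 1

/-- The (rescaled) nonlocal dipolar term. -/
def nlE (δ : ℝ) (Ω : Set Plane) : ℝ :=
  ∫ x : Plane, ∫ z : Plane, |ind Ω (x + z) - ind Ω x| ^ 2 * (gdel δ ‖z‖ / ‖z‖ ^ 3)

/-- The energy `E_{λ,δ}`. -/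
def Eenergy (lam δ : ℝ) (Ω : Set Plane) : ℝ :=
  perim Ω - lam / (4 * |Real.log δ|) * nlE δ Ω

end

/-- The set of `divg`-integrals is never empty. -/
theorem zero_mem_perimVals (Ω : Set Plane) : (0 : ℝ) ∈ perimVals Ω :=
  ⟨fun _ => 0, contDiff_const, HasCompactSupport.zero, by simp, by simp [divg]⟩

theorem perim_nonneg {Ω : Set Plane} (h : HasFinPer Ω) : 0 ≤ perim Ω :=
  le_csSup h (zero_mem_perimVals Ω)

theorem setIntegral_divg (Ω : Set Plane) (hΩ : MeasurableSet Ω) (φ : Plane → Plane) :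
    ∫ x in Ω, divg φ x = ∫ x, ind Ω x * divg φ x := by
  rw [← integral_indicator hΩ]
  congr 1
  ext x
  by_cases hx : x ∈ Ω <;> simp [ind, hx]

theorem integral_ind_mul_divg_le_perim {Ω : Set Plane} (hΩ : MeasurableSet Ω)
    (h : HasFinPer Ω) {φ : Plane → Plane} (h1 : ContDiff ℝ 1 φ) (h2 : HasCompactSupport φ)
    (h3 : ∀ x, ‖φ x‖ ≤ 1) : ∫ x, ind Ω x * divg φ x ≤ perim Ω :=
  le_csSup h ⟨φ, h1, h2, h3, (setIntegral_divg Ω hΩ φ).symm⟩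

open Pointwise in
theorem ind_inv_smul {α : ℝ} (hα : α ≠ 0) (Ω : Set Plane) (x : Plane) :
    ind (α⁻¹ • Ω) x = ind Ω (α • x) := by
  have : x ∈ α⁻¹ • Ω ↔ α • x ∈ Ω := by
    rw [Set.mem_smul_set_iff_inv_smul_mem₀ (inv_ne_zero hα), inv_inv]
  by_cases hx : α • x ∈ Ω <;> simp [ind, this, hx]

theorem integral_plane_comp_smul (f : Plane → ℝ) (α : ℝ) :
    ∫ x, f (α • x) = (α ^ 2)⁻¹ * ∫ x, f x := by
  rw [Measure.integral_comp_smul]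
  simp

theorem divg_comp_smul (φ : Plane → Plane) (c : ℝ) (x : Plane) :
    divg (fun y => φ (c • y)) x = c * divg φ (c • x) := by
  have h : fderiv ℝ (fun y => φ (c • y)) x = c • fderiv ℝ φ (c • x) := fderiv_comp_smul c
  simp [divg, h, mul_add]

open Pointwise in
theorem mul_perim_inv_smul_le {α : ℝ} (hα : 0 < α) {Ω : Set Plane} (hΩ : MeasurableSet Ω)
    (h : HasFinPer Ω) : α * perim (α⁻¹ • Ω) ≤ perim Ω := by
  rw [← le_div_iff₀' hα]
  refine csSup_le ⟨0, zero_mem_perimVals _⟩ ?_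
  rintro s ⟨φ, h1, h2, h3, rfl⟩
  have key := integral_ind_mul_divg_le_perim hΩ h (φ := fun y => φ (α⁻¹ • y))
    (by fun_prop) (h2.comp_smul (inv_ne_zero hα.ne')) (fun x => h3 _)
  rw [setIntegral_divg _ (hΩ.const_smul₀ _), le_div_iff₀' hα]
  refine le_trans (le_of_eq ?_) key
  have e1 : ∀ x, ind (α⁻¹ • Ω) x * divg φ x
      = (fun y => ind Ω y * divg φ (α⁻¹ • y)) (α • x) := by
    intro x
    simp only [ind_inv_smul hα.ne', inv_smul_smul₀ hα.ne']
  rw [integral_congr_ae (.of_forall e1),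
    integral_plane_comp_smul (fun y => ind Ω y * divg φ (α⁻¹ • y))]
  simp_rw [divg_comp_smul, mul_left_comm _ α⁻¹]
  rw [integral_const_mul]
  field_simp

open Pointwise in
theorem mul_nlE_inv_smul {α : ℝ} (hα : 0 < α) (δ : ℝ) (Ω : Set Plane) :
    α * nlE δ (α⁻¹ • Ω) = nlE (α * δ) Ω := by
  unfold nlE
  set H : Plane → Plane → ℝ := fun x z =>
    |ind Ω (x + z) - ind Ω x| ^ 2 * (gdel (α * δ) ‖z‖ / ‖z‖ ^ 3) with hH
  have e1 : ∀ x z : Plane, |ind (α⁻¹ • Ω) (x + z) - ind (α⁻¹ • Ω) x| ^ 2 *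
      (gdel δ ‖z‖ / ‖z‖ ^ 3) = α ^ 3 * H (α • x) (α • z) := by
    intro x z
    have : gdel (α * δ) (α * ‖z‖) = gdel δ ‖z‖ := by
      simp [gdel, hα]
    simp only [hH, ind_inv_smul hα.ne', smul_add, norm_smul, Real.norm_eq_abs, abs_of_pos hα, this]
    field_simp
  have e2 : ∀ x : Plane, ∫ z : Plane, α ^ 3 * H (α • x) (α • z) = α * ∫ z, H (α • x) z := by
    intro x
    rw [integral_const_mul, integral_plane_comp_smul]
    field_simp
  simp_rw [e1, e2]
  rw [integral_const_mul, integral_plane_comp_smul (fun x => ∫ z, H x z),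
    ← mul_assoc, ← mul_assoc, show α * α * (α ^ 2)⁻¹ = 1 by field_simp, one_mul]

theorem continuous_divg {φ : Plane → Plane} (h : ContDiff ℝ 1 φ) : Continuous (divg φ) := by
  have := h.continuous_fderiv one_ne_zero
  unfold divg
  fun_prop

theorem hasCompactSupport_divg {φ : Plane → Plane} (h : HasCompactSupport φ) :
    HasCompactSupport (divg φ) :=
  (h.fderiv (𝕜 := ℝ)).comp_left
    (g := fun L : Plane →L[ℝ] Plane => ∑ i : Fin 2, L (EuclideanSpace.single i 1) i) (by simp)

theorem divg_comp_add (φ : Plane → Plane) (t x : Plane) :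
    divg (fun y => φ (y + t)) x = divg φ (x + t) := by
  simp [divg, fderiv_comp_add_right]

theorem measurable_ind {Ω : Set Plane} (hΩ : MeasurableSet Ω) : Measurable (ind Ω) :=
  measurable_one.indicator hΩ

theorem abs_ind_le_one (Ω : Set Plane) (x : Plane) : |ind Ω x| ≤ 1 := by
  by_cases hx : x ∈ Ω <;> simp [ind, hx]

/-- Mollification does not increase the variation. -/
theorem integral_mollify_mul_divg_le_perim {Ω : Set Plane} (hΩ : MeasurableSet Ω)
    (h : HasFinPer Ω) {ρ : Plane → ℝ} (hρ : Continuous ρ) (hρc : HasCompactSupport ρ)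
    (hρ0 : ∀ t, 0 ≤ ρ t) (hρ1 : ∫ t, ρ t = 1)
    {φ : Plane → Plane} (h1 : ContDiff ℝ 1 φ) (h2 : HasCompactSupport φ)
    (h3 : ∀ x, ‖φ x‖ ≤ 1) :
    ∫ x, (∫ t, ρ t * ind Ω (x - t)) * divg φ x ≤ perim Ω := by
  have hm := measurable_ind hΩ
  have hρi : Integrable ρ := hρ.integrable_of_hasCompactSupport hρc
  have hdi : Integrable (divg φ) :=
    (continuous_divg h1).integrable_of_hasCompactSupport (hasCompactSupport_divg h2)
  have hint : Integrable (Function.uncurry fun x t : Plane => ρ t * ind Ω (x - t) * divg φ x)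
      (volume.prod volume) := by
    refine (hdi.norm.mul_prod hρi.norm).mono' ?_ (.of_forall ?_)
    · have := (continuous_divg h1).measurable
      have := hρ.measurable
      refine Measurable.aestronglyMeasurable ?_
      unfold Function.uncurry
      fun_prop
    · rintro ⟨x, t⟩
      simp only [Function.uncurry, norm_mul, Real.norm_eq_abs]
      calc |ρ t| * |ind Ω (x - t)| * |divg φ x| ≤ |ρ t| * 1 * |divg φ x| := by
            gcongr; exact abs_ind_le_one _ _
        _ = _ := by ring
  simp_rw [← integral_mul_const]
  rw [integral_integral_swap hint]
  calc ∫ t, ∫ x, ρ t * ind Ω (x - t) * divg φ x ≤ ∫ t, ρ t * perim Ω := by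
        refine integral_mono hint.integral_prod_right (hρi.mul_const _) fun t => ?_
        simp only [mul_assoc]
        rw [integral_const_mul]
        refine mul_le_mul_of_nonneg_left ?_ (hρ0 t)
        rw [← integral_add_right_eq_self _ t]
        have := integral_ind_mul_divg_le_perim hΩ h (φ := fun y => φ (y + t))
          (by fun_prop) (h2.comp_homeomorph (Homeomorph.addRight t)) (fun x => h3 _)
        simpa only [divg_comp_add, add_sub_cancel_right] using this
    _ = perim Ω := by rw [integral_mul_const, hρ1, one_mul]

theorem integral_mul_divg {u : Plane → ℝ} (hu : ContDiff ℝ 1 u) {φ : Plane → Plane}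
    (h1 : ContDiff ℝ 1 φ) (h2 : HasCompactSupport φ) :
    ∫ x, u x * divg φ x = -∫ x, fderiv ℝ u x (φ x) := by
  have hu' := hu.continuous_fderiv one_ne_zero
  have hφ' := h1.continuous_fderiv one_ne_zero
  have hφc := h1.continuous
  have huc := hu.continuous
  have hci : ∀ i : Fin 2, HasCompactSupport fun x => φ x i := fun i =>
    h2.comp_left (g := fun v : Plane => v i) rfl
  have hfd : ∀ (i : Fin 2) (x : Plane),
      fderiv ℝ φ x (EuclideanSpace.single i 1) i
        = fderiv ℝ (fun y => φ y i) x (EuclideanSpace.single i 1) := by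
    intro i x
    have hd : HasFDerivAt φ (fderiv ℝ φ x) x :=
      (h1.differentiable one_ne_zero x).hasFDerivAt
    have := ((EuclideanSpace.proj (𝕜 := ℝ) i).hasFDerivAt (x := φ x)).comp x hd
    have e := this.fderiv
    change fderiv ℝ (fun y => φ y i) x = _ at e
    rw [e]
    rfl
  have i1 : ∀ i : Fin 2, Integrable fun x =>
      u x * fderiv ℝ (fun y => φ y i) x (EuclideanSpace.single i 1) := by
    intro i
    refine Continuous.integrable_of_hasCompactSupport ?_
      (((hci i).fderiv_apply (𝕜 := ℝ) _).mul_left)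
    simp_rw [← hfd]
    fun_prop
  have i2 : ∀ i : Fin 2, Integrable fun x =>
      fderiv ℝ u x (EuclideanSpace.single i 1) * φ x i := fun i =>
    Continuous.integrable_of_hasCompactSupport (by fun_prop) (hci i).mul_left
  have i3 : ∀ i : Fin 2, Integrable fun x => u x * φ x i := fun i =>
    Continuous.integrable_of_hasCompactSupport (by fun_prop) (hci i).mul_left
  have hsum : ∀ x, fderiv ℝ u x (φ x)
      = ∑ i : Fin 2, fderiv ℝ u x (EuclideanSpace.single i 1) * φ x i := by
    intro x
    have hv : φ x = ∑ i : Fin 2, φ x i • EuclideanSpace.single i (1 : ℝ) := by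
      ext j
      fin_cases j <;> simp
    conv_lhs => rw [hv]
    simp [mul_comm]
  simp_rw [hsum, divg, hfd, Finset.mul_sum]
  rw [integral_finsetSum _ fun i _ => i1 i, integral_finsetSum _ fun i _ => i2 i,
    ← Finset.sum_neg_distrib]
  refine Finset.sum_congr rfl fun i _ => ?_
  exact integral_mul_fderiv_eq_neg_fderiv_mul_of_integrable (i2 i) (i1 i) (i3 i)
    (fun x _ => hu.differentiable one_ne_zero x)
    (fun x _ => (by fun_prop : ContDiff ℝ 1 fun y => φ y i).differentiable one_ne_zero x)

/-- The dual bound on `∫ u div φ` controls the total variation of a smooth function. -/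
theorem lintegral_norm_gradient_le {u : Plane → ℝ} (hu : ContDiff ℝ 2 u) {P : ℝ}
    (h : ∀ φ : Plane → Plane, ContDiff ℝ 1 φ → HasCompactSupport φ → (∀ x, ‖φ x‖ ≤ 1) →
      ∫ x, u x * divg φ x ≤ P) :
    ∫⁻ x, ENNReal.ofReal ‖gradient u x‖ ≤ ENNReal.ofReal P := by
  have hG : ContDiff ℝ 1 (gradient u) :=
    (InnerProductSpace.toDual ℝ Plane).symm.contDiff.comp (hu.fderiv_right (m := 1) (by norm_num))
  have hGc := hG.continuous
  let κ : ℕ → ContDiffBump (0 : Plane) := fun n => ⟨n + 1, n + 2, by positivity, by linarith⟩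
  let η : ℕ → ℝ := fun n => 1 / ((n : ℝ) + 1)
  have hη : ∀ n, 0 < η n := fun n => by positivity
  let s : ℕ → Plane → ℝ := fun n x => √(‖gradient u x‖ ^ 2 + η n ^ 2)
  have hs0 : ∀ n x, 0 < s n x := fun n x => by have := hη n; positivity
  have hs : ∀ n, ContDiff ℝ 1 (s n) := fun n =>
    ((hG.norm_sq ℝ).add contDiff_const).sqrt fun x => by have := hη n; positivity
  have hgs : ∀ n x, ‖gradient u x‖ ≤ s n x := fun n x =>
    Real.le_sqrt_of_sq_le (by have := sq_nonneg (η n); linarith)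
  let f : ℕ → Plane → ℝ := fun n x => κ n x * (‖gradient u x‖ ^ 2 / s n x)
  have hf0 : ∀ n x, 0 ≤ f n x := fun n x =>
    mul_nonneg (κ n).nonneg (div_nonneg (sq_nonneg _) (hs0 n x).le)
  have hfc : ∀ n, Continuous (f n) := fun n =>
    (κ n).continuous.mul ((hGc.norm.pow 2).div (hs n).continuous fun x => (hs0 n x).ne')
  have hfi : ∀ n, Integrable (f n) := fun n =>
    (hfc n).integrable_of_hasCompactSupport (κ n).hasCompactSupport.mul_right
  have hbound : ∀ n, ∫⁻ x, ENNReal.ofReal (f n x) ≤ ENNReal.ofReal P := by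
    intro n
    rw [← ofReal_integral_eq_lintegral_ofReal (hfi n) (.of_forall (hf0 n))]
    refine ENNReal.ofReal_le_ofReal ?_
    have hφ1 : ContDiff ℝ 1 fun x => (-(κ n x / s n x)) • gradient u x :=
      (((κ n).contDiff.div (hs n) fun x => (hs0 n x).ne').neg).smul hG
    have hφ2 : HasCompactSupport fun x => (-(κ n x / s n x)) • gradient u x := by
      refine HasCompactSupport.smul_right (f := fun x => -(κ n x / s n x)) ?_
      simp_rw [div_eq_mul_inv, ← neg_mul]
      exact HasCompactSupport.mul_right (κ n).hasCompactSupport.neg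
    have key := h _ hφ1 hφ2 fun x => by
      rw [norm_smul, norm_neg, Real.norm_eq_abs,
        abs_of_nonneg (div_nonneg (κ n).nonneg (hs0 n x).le), div_mul_eq_mul_div,
        div_le_one (hs0 n x)]
      calc κ n x * ‖gradient u x‖ ≤ 1 * s n x := by
            gcongr
            · exact (κ n).le_one
            · exact hgs n x
        _ = _ := one_mul _
    rw [integral_mul_divg (hu.of_le (by norm_num)) hφ1 hφ2, ← integral_neg] at key
    refine le_trans (le_of_eq (integral_congr_ae (.of_forall fun x => ?_))) key
    have e : fderiv ℝ u x (gradient u x) = ‖gradient u x‖ ^ 2 := by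
      rw [← inner_gradient_left, real_inner_self_eq_norm_sq]
    simp only [f, map_smul, smul_eq_mul, e]
    ring
  have hlim : ∀ x, Tendsto (fun n => f n x) atTop (nhds ‖gradient u x‖) := by
    intro x
    by_cases hg : ‖gradient u x‖ = 0
    · simp [f, hg]
    have hη0 : Tendsto η atTop (nhds 0) := tendsto_one_div_add_atTop_nhds_zero_nat
    have h1 : Tendsto (fun n => ‖gradient u x‖ ^ 2 / s n x) atTop
        (nhds (‖gradient u x‖ ^ 2 / √(‖gradient u x‖ ^ 2 + 0 ^ 2))) := by
      refine tendsto_const_nhds.div ?_ (by simpa using hg)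
      exact (tendsto_const_nhds.add (hη0.pow 2)).sqrt
    have e : ‖gradient u x‖ ^ 2 / √(‖gradient u x‖ ^ 2 + 0 ^ 2) = ‖gradient u x‖ := by
      rw [zero_pow two_ne_zero, add_zero, Real.sqrt_sq (norm_nonneg _)]
      field_simp
    rw [e] at h1
    refine h1.congr' ?_
    filter_upwards [eventually_ge_atTop ⌈‖x‖⌉₊] with n hn
    have : κ n x = 1 := (κ n).one_of_mem_closedBall (by
      simp only [κ, Metric.mem_closedBall, dist_zero_right]
      have := Nat.ceil_le.1 hn
      linarith)
    simp [f, this]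
  calc ∫⁻ x, ENNReal.ofReal ‖gradient u x‖
      = ∫⁻ x, liminf (fun n => ENNReal.ofReal (f n x)) atTop :=
        lintegral_congr fun x =>
          ((ENNReal.continuous_ofReal.tendsto _).comp (hlim x)).liminf_eq.symm
    _ ≤ liminf (fun n => ∫⁻ x, ENNReal.ofReal (f n x)) atTop :=
        lintegral_liminf_le fun n => (hfc n).measurable.ennreal_ofReal
    _ ≤ liminf (fun _ : ℕ => ENNReal.ofReal P) atTop :=
        liminf_le_liminf (.of_forall hbound)
    _ = ENNReal.ofReal P := by simp

theorem lintegral_translate_sub_le {u : Plane → ℝ} (hu : ContDiff ℝ 1 u) (z : Plane) :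
    ∫⁻ x, ‖u (x + z) - u x‖ₑ ≤ ∫⁻ x, ‖fderiv ℝ u x z‖ₑ := by
  have hu' := hu.continuous_fderiv one_ne_zero
  have hpt : ∀ x, ‖u (x + z) - u x‖ₑ
      ≤ ∫⁻ t in Ioc (0 : ℝ) 1, ‖fderiv ℝ u (x + t • z) z‖ₑ := by
    intro x
    have hd : ∀ t ∈ uIcc (0 : ℝ) 1, HasDerivAt (fun t : ℝ => u (x + t • z))
        (fderiv ℝ u (x + t • z) z) t := by
      intro t _
      have h1 : HasDerivAt (fun t : ℝ => x + t • z) z t := by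
        simpa using ((hasDerivAt_id t).smul_const z).const_add x
      exact ((hu.differentiable one_ne_zero _).hasFDerivAt).comp_hasDerivAt t h1
    have := intervalIntegral.integral_eq_sub_of_hasDerivAt hd
      (Continuous.intervalIntegrable (by fun_prop) _ _)
    simp only [one_smul, zero_smul, add_zero] at this
    rw [← this, intervalIntegral.integral_of_le zero_le_one]
    exact enorm_integral_le_lintegral_enorm _
  calc ∫⁻ x, ‖u (x + z) - u x‖ₑ
      ≤ ∫⁻ x, ∫⁻ t in Ioc (0 : ℝ) 1, ‖fderiv ℝ u (x + t • z) z‖ₑ := lintegral_mono hpt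
    _ = ∫⁻ t in Ioc (0 : ℝ) 1, ∫⁻ x, ‖fderiv ℝ u (x + t • z) z‖ₑ := by
        refine lintegral_lintegral_swap (Continuous.measurable ?_).aemeasurable
        unfold Function.uncurry
        fun_prop
    _ = ∫⁻ t in Ioc (0 : ℝ) 1, ∫⁻ x, ‖fderiv ℝ u x z‖ₑ := by
        refine lintegral_congr fun t => ?_
        exact lintegral_add_right_eq_self (fun x => ‖fderiv ℝ u x z‖ₑ) (t • z)
    _ = ∫⁻ x, ‖fderiv ℝ u x z‖ₑ := by simp

/-- The kernel `|z|⁻³` restricted to the annulus `δ < |z| ≤ δ'`, as a function of `|z|`. -/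
noncomputable def annKer (δ δ' r : ℝ) : ℝ := (Ioc δ δ').indicator (fun r => (r ^ 3)⁻¹) r

theorem measurable_annKer (δ δ' : ℝ) : Measurable (annKer δ δ') :=
  (by fun_prop : Measurable fun r : ℝ => (r ^ 3)⁻¹).indicator measurableSet_Ioc

theorem annKer_nonneg {δ : ℝ} (hδ : 0 < δ) (δ' r : ℝ) : 0 ≤ annKer δ δ' r := by
  refine Set.indicator_nonneg (fun r hr => ?_) r
  have := hδ.trans hr.1
  positivity

theorem gdel_sub_gdel_div {δ δ' : ℝ} (h : δ ≤ δ') (r : ℝ) :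
    gdel δ r / r ^ 3 = gdel δ' r / r ^ 3 + annKer δ δ' r := by
  unfold gdel annKer
  by_cases h1 : δ < r
  · by_cases h2 : δ' < r
    · simp [h1, h2, h2.not_ge]
    · simp [h1, h2, not_lt.1 h2]
  · have h2 : ¬ δ' < r := fun h2 => h1 (h.trans_lt h2)
    simp [h1, h2]

theorem intervalIntegral_abs_cos : ∫ θ in (-π)..π, |cos θ| = 4 := by
  have hi : ∀ a b : ℝ, IntervalIntegrable (fun θ => |cos θ|) volume a b := fun a b =>
    Continuous.intervalIntegrable (by fun_prop) _ _
  have hper : Function.Periodic (fun θ => |cos θ|) π := fun θ => by simp [cos_add_pi]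
  have h0 : ∫ θ in (-(π / 2))..(-(π / 2) + π), |cos θ| = 2 := by
    have : ∫ θ in (-(π / 2))..(-(π / 2) + π), |cos θ|
        = ∫ θ in (-(π / 2))..(-(π / 2) + π), cos θ := by
      refine intervalIntegral.integral_congr fun θ hθ => ?_
      rw [uIcc_of_le (by linarith [pi_pos])] at hθ
      exact abs_of_nonneg (cos_nonneg_of_mem_Icc ⟨hθ.1, by linarith [hθ.2]⟩)
    rw [this, integral_cos, show -(π / 2) + π = π / 2 by ring]
    simp
    norm_num
  have h1 := hper.intervalIntegral_add_eq (-π) (-(π / 2))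
  have h2 := hper.intervalIntegral_add_eq 0 (-(π / 2))
  rw [neg_add_cancel] at h1
  rw [zero_add] at h2
  rw [← intervalIntegral.integral_add_adjacent_intervals (hi (-π) 0) (hi 0 π), h1, h2, h0]
  norm_num

theorem intervalIntegral_abs_cos_sin (a b : ℝ) :
    ∫ θ in (-π)..π, |a * cos θ + b * sin θ| = 4 * √(a ^ 2 + b ^ 2) := by
  set c : ℂ := ⟨a, b⟩ with hc
  have ha : ‖c‖ * cos c.arg = a := Complex.norm_mul_cos_arg c
  have hb : ‖c‖ * sin c.arg = b := Complex.norm_mul_sin_arg c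
  have hn : ‖c‖ = √(a ^ 2 + b ^ 2) := by
    rw [Complex.norm_def, Complex.normSq_apply]
    simp [hc, sq]
  have e : ∀ θ, |a * cos θ + b * sin θ| = ‖c‖ * |cos (θ - c.arg)| := by
    intro θ
    nth_rewrite 1 [← ha, ← hb]
    rw [cos_sub, ← abs_norm c, ← abs_mul, abs_norm]
    congr 1
    ring
  have hper : Function.Periodic (fun θ => |cos θ|) (2 * π) := fun θ => by simp
  have h1 := hper.intervalIntegral_add_eq (-π - c.arg) (-π)
  rw [show -π - c.arg + 2 * π = π - c.arg by ring, show -π + 2 * π = π by ring,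
    intervalIntegral_abs_cos] at h1
  simp_rw [e]
  rw [intervalIntegral.integral_const_mul,
    intervalIntegral.integral_comp_sub_right (fun θ => |cos θ|), h1, hn, mul_comm]

theorem lintegral_plane_eq_polar (F : Plane → ENNReal) :
    ∫⁻ z, F z = ∫⁻ p in Ioi (0 : ℝ) ×ˢ Ioo (-π) π,
      ENNReal.ofReal p.1 * F !₂[p.1 * cos p.2, p.1 * sin p.2] := by
  let e : Plane ≃ᵐ ℝ × ℝ := (MeasurableEquiv.toLp 2 (Fin 2 → ℝ)).symm.trans
    MeasurableEquiv.finTwoArrow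
  have he : MeasurePreserving e :=
    (EuclideanSpace.volume_preserving_symm_measurableEquiv_toLp (Fin 2)).trans
      (volume_preserving_finTwoArrow ℝ)
  rw [← (he.symm).lintegral_comp_emb e.symm.measurableEmbedding, ← lintegral_comp_polarCoord_symm]
  rfl

/-- The integral of `|⟪v, z⟫| / |z|³` over an annulus. -/
theorem lintegral_annKer_mul_inner {δ δ' : ℝ} (hδ : 0 < δ) (h : δ ≤ δ') (v : Plane) :
    ∫⁻ z : Plane, ENNReal.ofReal (annKer δ δ' ‖z‖) * ‖inner ℝ v z‖ₑ
      = ENNReal.ofReal (4 * log (δ' / δ)) * ENNReal.ofReal ‖v‖ := by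
  have hv : ‖v‖ = √(v 0 ^ 2 + v 1 ^ 2) := by
    rw [EuclideanSpace.norm_eq]; simp
  have hpt : ∀ p ∈ Ioi (0 : ℝ) ×ˢ Ioo (-π) π,
      ENNReal.ofReal p.1 * (ENNReal.ofReal (annKer δ δ' ‖!₂[p.1 * cos p.2, p.1 * sin p.2]‖) *
        ‖inner ℝ v !₂[p.1 * cos p.2, p.1 * sin p.2]‖ₑ)
      = (Ioc δ δ').indicator (fun r => ENNReal.ofReal r⁻¹) p.1 *
        ENNReal.ofReal |v 0 * cos p.2 + v 1 * sin p.2| := by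
    rintro ⟨r, θ⟩ ⟨hr, -⟩
    have hr : 0 < r := hr
    have hn : ‖(!₂[r * cos θ, r * sin θ] : Plane)‖ = r := by
      rw [EuclideanSpace.norm_eq]
      simp only [Fin.sum_univ_two, Real.norm_eq_abs, sq_abs]
      have : (r * cos θ) ^ 2 + (r * sin θ) ^ 2 = r ^ 2 := by
        linear_combination r ^ 2 * cos_sq_add_sin_sq θ
      simp [this, hr.le]
    have hi : ‖inner ℝ v !₂[r * cos θ, r * sin θ]‖ₑ
        = ENNReal.ofReal (r * |v 0 * cos θ + v 1 * sin θ|) := by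
      rw [← ofReal_norm, Real.norm_eq_abs]
      congr 1
      have e : inner ℝ v !₂[r * cos θ, r * sin θ] = r * (v 0 * cos θ + v 1 * sin θ) := by
        simp only [PiLp.inner_apply, Fin.sum_univ_two]
        simp
        ring
      rw [e, abs_mul, abs_of_pos hr]
    simp only [hn, hi]
    by_cases hrI : r ∈ Ioc δ δ'
    · rw [annKer, indicator_of_mem hrI, indicator_of_mem hrI, ← ENNReal.ofReal_mul (by positivity),
        ← ENNReal.ofReal_mul (by positivity), ← ENNReal.ofReal_mul (by positivity)]
      congr 1
      field_simp
    · rw [annKer, indicator_of_notMem hrI, indicator_of_notMem hrI]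
      simp
  have hr : ∫⁻ r in Ioi (0 : ℝ), (Ioc δ δ').indicator (fun r => ENNReal.ofReal r⁻¹) r
      = ENNReal.ofReal (log (δ' / δ)) := by
    rw [lintegral_indicator measurableSet_Ioc, Measure.restrict_restrict measurableSet_Ioc,
      inter_eq_left.2 (show Ioc δ δ' ⊆ Ioi 0 from fun r hr => hδ.trans hr.1), ← integral_inv_of_pos hδ (hδ.trans_le h),
      intervalIntegral.integral_of_le h]
    refine (ofReal_integral_eq_lintegral_ofReal ?_ ?_).symm
    · rw [← IntegrableOn, ← intervalIntegrable_iff_integrableOn_Ioc_of_le h]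
      refine intervalIntegral.intervalIntegrable_inv (fun x hx => ?_) continuousOn_id
      rw [uIcc_of_le h] at hx
      exact (hδ.trans_le hx.1).ne'
    · filter_upwards [ae_restrict_mem measurableSet_Ioc] with r hr
      exact inv_nonneg.2 (hδ.trans hr.1).le
  have hθ : ∫⁻ θ in Ioo (-π) π, ENNReal.ofReal |v 0 * cos θ + v 1 * sin θ|
      = ENNReal.ofReal (4 * ‖v‖) := by
    rw [hv, ← intervalIntegral_abs_cos_sin, intervalIntegral.integral_of_le (by linarith [pi_pos]),
      restrict_Ioo_eq_restrict_Ioc]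
    refine (ofReal_integral_eq_lintegral_ofReal ?_ (.of_forall fun _ => abs_nonneg _)).symm
    exact (Continuous.integrableOn_Icc (by fun_prop)).mono_set Ioc_subset_Icc_self
  have hlog : 0 ≤ log (δ' / δ) := log_nonneg ((one_le_div hδ).2 h)
  rw [lintegral_plane_eq_polar, setLIntegral_congr_fun (measurableSet_Ioi.prod measurableSet_Ioo)
    hpt, Measure.volume_eq_prod, ← Measure.prod_restrict,
    lintegral_prod_mul (f := (Ioc δ δ').indicator fun r => ENNReal.ofReal r⁻¹)
      (g := fun θ => ENNReal.ofReal |v 0 * cos θ + v 1 * sin θ|), hr, hθ,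
    ← ENNReal.ofReal_mul hlog, ← ENNReal.ofReal_mul (by positivity)]
  · congr 1
    ring
  · exact (Measurable.indicator (by fun_prop) measurableSet_Ioc).aemeasurable
  · exact Measurable.aemeasurable (by fun_prop)

theorem lintegral_annKer_translate_sub_le {δ δ' : ℝ} (hδ : 0 < δ) (h : δ ≤ δ') {u : Plane → ℝ}
    (hu : ContDiff ℝ 1 u) :
    ∫⁻ z : Plane, ∫⁻ x, ENNReal.ofReal (annKer δ δ' ‖z‖) * ‖u (x + z) - u x‖ₑ
      ≤ ENNReal.ofReal (4 * log (δ' / δ)) * ∫⁻ x, ENNReal.ofReal ‖gradient u x‖ := by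
  have hu' := hu.continuous_fderiv one_ne_zero
  have hk := measurable_annKer δ δ'
  calc ∫⁻ z : Plane, ∫⁻ x, ENNReal.ofReal (annKer δ δ' ‖z‖) * ‖u (x + z) - u x‖ₑ
      ≤ ∫⁻ z : Plane, ∫⁻ x, ENNReal.ofReal (annKer δ δ' ‖z‖) * ‖fderiv ℝ u x z‖ₑ := by
        refine lintegral_mono fun z => ?_
        dsimp only
        rw [lintegral_const_mul' _ _ ENNReal.ofReal_ne_top,
          lintegral_const_mul' _ _ ENNReal.ofReal_ne_top]
        exact mul_le_mul_right (lintegral_translate_sub_le hu z) _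
    _ = ∫⁻ x, ∫⁻ z : Plane, ENNReal.ofReal (annKer δ δ' ‖z‖) * ‖fderiv ℝ u x z‖ₑ := by
        refine lintegral_lintegral_swap (Measurable.aemeasurable ?_)
        have : Measurable fun p : Plane × Plane => fderiv ℝ u p.2 p.1 :=
          Continuous.measurable (by fun_prop)
        unfold Function.uncurry
        fun_prop
    _ = ∫⁻ x, ENNReal.ofReal (4 * log (δ' / δ)) * ENNReal.ofReal ‖gradient u x‖ := by
        refine lintegral_congr fun x => ?_
        rw [← lintegral_annKer_mul_inner hδ h]
        simp_rw [inner_gradient_left]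
    _ = _ := lintegral_const_mul' _ _ ENNReal.ofReal_ne_top

/-- A set of finite perimeter is an a.e. limit of smooth functions with no larger variation. -/
theorem exists_smooth_approx {Ω : Set Plane} (hΩ : MeasurableSet Ω) (hP : HasFinPer Ω) :
    ∃ u : ℕ → Plane → ℝ, (∀ n, ContDiff ℝ 2 (u n)) ∧
      (∀ᵐ x, Tendsto (fun n => u n x) atTop (nhds (ind Ω x))) ∧
      ∀ n, ∫⁻ x, ENNReal.ofReal ‖gradient (u n) x‖ ≤ ENNReal.ofReal (perim Ω) := by
  have hm := measurable_ind hΩ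
  have hloc : LocallyIntegrable (ind Ω) :=
    (locallyIntegrable_const (1 : ℝ)).mono hm.aestronglyMeasurable
      (.of_forall fun x => by simpa using abs_ind_le_one Ω x)
  have hr : ∀ n : ℕ, (0 : ℝ) < 1 / ((n : ℝ) + 1) := fun n => by positivity
  let κ : ℕ → ContDiffBump (0 : Plane) := fun n =>
    ⟨1 / ((n : ℝ) + 1), 2 * (1 / ((n : ℝ) + 1)), hr n, by linarith [hr n]⟩
  have hu : ∀ n, ContDiff ℝ 2 (convolution ((κ n).normed volume) (ind Ω)
      (ContinuousLinearMap.lsmul ℝ ℝ) volume) := fun n =>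
    (κ n).hasCompactSupport_normed.contDiff_convolution_left (n := 2) _ (κ n).contDiff_normed hloc
  refine ⟨_, hu, ?_, fun n => ?_⟩
  · refine ContDiffBump.ae_convolution_tendsto_right_of_locallyIntegrable (K := 2) ?_
      (.of_forall fun n => le_rfl) hloc
    have := (tendsto_one_div_add_atTop_nhds_zero_nat (𝕜 := ℝ)).const_mul 2
    rwa [mul_zero] at this
  · refine lintegral_norm_gradient_le (hu n) fun φ h1 h2 h3 => ?_
    exact integral_mollify_mul_divg_le_perim hΩ hP (κ n).continuous_normed
      (κ n).hasCompactSupport_normed (κ n).nonneg_normed (κ n).integral_normed h1 h2 h3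

/-- The sharp small-scale perimeter estimate. -/
theorem lintegral_annKer_ind_le {δ δ' : ℝ} (hδ : 0 < δ) (h : δ ≤ δ') {Ω : Set Plane}
    (hΩ : MeasurableSet Ω) (hP : HasFinPer Ω) :
    ∫⁻ z : Plane, ∫⁻ x, ENNReal.ofReal (annKer δ δ' ‖z‖) * ‖ind Ω (x + z) - ind Ω x‖ₑ
      ≤ ENNReal.ofReal (4 * log (δ' / δ) * perim Ω) := by
  have hk := measurable_annKer δ δ'
  obtain ⟨u, hu, hconv, hgrad⟩ := exists_smooth_approx hΩ hP
  have huc : ∀ n, Continuous (u n) := fun n => (hu n).continuous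
  have hlog : 0 ≤ log (δ' / δ) := log_nonneg ((one_le_div hδ).2 h)
  have hbound : ∀ n, ∫⁻ z : Plane, ∫⁻ x,
      ENNReal.ofReal (annKer δ δ' ‖z‖) * ‖u n (x + z) - u n x‖ₑ
      ≤ ENNReal.ofReal (4 * log (δ' / δ) * perim Ω) := fun n => by
    refine (lintegral_annKer_translate_sub_le hδ h ((hu n).of_le (by norm_num))).trans ?_
    rw [ENNReal.ofReal_mul (p := 4 * log (δ' / δ)) (by positivity)]
    exact mul_le_mul_right (hgrad n) _
  have hmeas : ∀ n, Measurable fun p : Plane × Plane =>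
      ENNReal.ofReal (annKer δ δ' ‖p.1‖) * ‖u n (p.2 + p.1) - u n p.2‖ₑ := fun n => by
    have := (huc n).measurable
    fun_prop
  have hinner : ∀ z : Plane,
      ∫⁻ x, ENNReal.ofReal (annKer δ δ' ‖z‖) * ‖ind Ω (x + z) - ind Ω x‖ₑ ≤
        liminf (fun n => ∫⁻ x, ENNReal.ofReal (annKer δ δ' ‖z‖) * ‖u n (x + z) - u n x‖ₑ)
          atTop := by
    intro z
    have hz : ∀ᵐ x, Tendsto (fun n => u n (x + z)) atTop (nhds (ind Ω (x + z))) :=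
      (measurePreserving_add_right volume z).quasiMeasurePreserving.ae hconv
    have hmz : ∀ n, Measurable fun x =>
        ENNReal.ofReal (annKer δ δ' ‖z‖) * ‖u n (x + z) - u n x‖ₑ := fun n => by
      have := (huc n).measurable
      fun_prop
    refine le_trans (le_of_eq (lintegral_congr_ae ?_)) (lintegral_liminf_le hmz)
    filter_upwards [hconv, hz] with x h1 h2
    exact (ENNReal.Tendsto.const_mul (h2.sub h1).enorm
      (Or.inr ENNReal.ofReal_ne_top)).liminf_eq.symm
  have hmouter : ∀ n, Measurable fun z : Plane => ∫⁻ x,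
      ENNReal.ofReal (annKer δ δ' ‖z‖) * ‖u n (x + z) - u n x‖ₑ := fun n =>
    (hmeas n).lintegral_prod_right'
  refine (lintegral_mono hinner).trans ((lintegral_liminf_le hmouter).trans ?_)
  exact liminf_le_of_frequently_le' (.of_forall hbound)

theorem integrable_gdel_div {δ : ℝ} (hδ : 0 < δ) :
    Integrable fun z : Plane => gdel δ ‖z‖ / ‖z‖ ^ 3 := by
  have hJ : Integrable fun z : Plane => (1 + ‖z‖) ^ (-(3 : ℝ)) :=
    integrable_one_add_norm (by simp; norm_num)
  refine (hJ.const_mul (((1 + δ) / δ) ^ 3)).mono' ?_ (.of_forall fun z => ?_)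
  · have : Measurable fun r : ℝ => gdel δ r :=
      Measurable.ite measurableSet_Ioi measurable_const measurable_const
    exact Measurable.aestronglyMeasurable (by fun_prop)
  · unfold gdel
    split_ifs with hz
    · have hz0 : 0 < ‖z‖ := hδ.trans hz
      rw [Real.rpow_neg (by positivity), show (3 : ℝ) = (3 : ℕ) by norm_num, Real.rpow_natCast,
        Real.norm_eq_abs, abs_of_pos (by positivity), ← div_eq_mul_inv, ← div_pow, ← one_div_pow]
      refine pow_le_pow_left₀ (by positivity) ?_ 3
      rw [div_div, div_le_div_iff₀ (by positivity) (by positivity)]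
      nlinarith
    · simp only [zero_div, norm_zero]
      positivity

theorem nlE_sub_nlE_le {δ δ' : ℝ} (hδ : 0 < δ) (h : δ ≤ δ') {Ω : Set Plane}
    (hΩ : MeasurableSet Ω) (hP : HasFinPer Ω) :
    nlE δ Ω - nlE δ' Ω ≤ 4 * log (δ' / δ) * perim Ω := by
  have hm := measurable_ind hΩ
  have hk := measurable_annKer δ δ'
  have hlog : 0 ≤ log (δ' / δ) := log_nonneg ((one_le_div hδ).2 h)
  have hP0 := perim_nonneg hP
  have hsq : ∀ x z, |ind Ω (x + z) - ind Ω x| ^ 2 = |ind Ω (x + z) - ind Ω x| := fun x z => by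
    by_cases h1 : x + z ∈ Ω <;> by_cases h2 : x ∈ Ω <;> simp [ind, h1, h2]
  have hle : ∀ x z, |ind Ω (x + z) - ind Ω x| ≤ 1 := fun x z => by
    by_cases h1 : x + z ∈ Ω <;> by_cases h2 : x ∈ Ω <;> simp [ind, h1, h2]
  have hinner : ∀ {k : Plane → ℝ}, Integrable k → ∀ x,
      Integrable fun z => |ind Ω (x + z) - ind Ω x| ^ 2 * k z := fun {k} hki x => by
    refine hki.bdd_mul (c := 1) (Measurable.aestronglyMeasurable (by fun_prop))
      (.of_forall fun z => ?_)
    rw [hsq, Real.norm_eq_abs, abs_abs]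
    exact hle x z
  have hki : Integrable fun z : Plane => annKer δ δ' ‖z‖ := by
    refine ((integrable_gdel_div hδ).sub (integrable_gdel_div (hδ.trans_le h))).congr
      (.of_forall fun z => ?_)
    simp [gdel_sub_gdel_div h]
  let F : Plane → ℝ := fun x => ∫ z, |ind Ω (x + z) - ind Ω x| ^ 2 * (gdel δ' ‖z‖ / ‖z‖ ^ 3)
  let G : Plane → ℝ := fun x => ∫ z, |ind Ω (x + z) - ind Ω x| ^ 2 * annKer δ δ' ‖z‖
  have hFG : nlE δ Ω = ∫ x, (F x + G x) := by
    unfold nlE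
    congr 1
    ext x
    rw [← integral_add (hinner (integrable_gdel_div (hδ.trans_le h)) x) (hinner hki x)]
    simp_rw [gdel_sub_gdel_div h, mul_add]
  have hG0 : ∀ x, 0 ≤ G x := fun x => integral_nonneg fun z =>
    mul_nonneg (sq_nonneg _) (annKer_nonneg hδ _ _)
  have hGm : AEStronglyMeasurable G := by
    have : Measurable fun p : Plane × Plane =>
        |ind Ω (p.1 + p.2) - ind Ω p.1| ^ 2 * annKer δ δ' ‖p.2‖ := by fun_prop
    exact this.stronglyMeasurable.integral_prod_right'.aestronglyMeasurable
  have hGl : ∫⁻ x, ENNReal.ofReal (G x) ≤ ENNReal.ofReal (4 * log (δ' / δ) * perim Ω) := by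
    refine le_trans (le_of_eq ?_) (lintegral_annKer_ind_le hδ h hΩ hP)
    rw [lintegral_lintegral_swap]
    · refine lintegral_congr fun x => ?_
      rw [ofReal_integral_eq_lintegral_ofReal (hinner hki x)
        (.of_forall fun z => mul_nonneg (sq_nonneg _) (annKer_nonneg hδ _ _))]
      refine lintegral_congr fun z => ?_
      rw [hsq, ENNReal.ofReal_mul (abs_nonneg _), mul_comm, ← ofReal_norm,
        Real.norm_eq_abs]
    · refine Measurable.aemeasurable ?_
      unfold Function.uncurry
      fun_prop
  have hGi : Integrable G := by
    refine ⟨hGm, ?_⟩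
    rw [hasFiniteIntegral_iff_ofReal (.of_forall hG0)]
    exact hGl.trans_lt ENNReal.ofReal_lt_top
  have hGle : ∫ x, G x ≤ 4 * log (δ' / δ) * perim Ω := by
    rw [integral_eq_lintegral_of_nonneg_ae (.of_forall hG0) hGm]
    exact ENNReal.toReal_le_of_le_ofReal (by positivity) hGl
  have hFn : nlE δ' Ω = ∫ x, F x := rfl
  by_cases hF : Integrable F
  · rw [hFG, hFn, integral_add hF hGi]
    linarith
  · have hF' : ¬ Integrable fun x => F x + G x := fun hc => hF ((hc.sub hGi).congr
      (.of_forall fun x => by simp))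
    rw [hFG, hFn, integral_undef hF, integral_undef hF']
    simpa using by positivity

open Pointwise in
/-- Upper bound on the energy increase under dilation by `α⁻¹` with
`α > 1`. -/
theorem stmt16 (lam δ α : ℝ) (hlam : 0 < lam) (hδ0 : 0 < δ) (hδ : δ < 1 / 2)
    (hα : 1 < α) (Ω : Set Plane) (hmeas : MeasurableSet Ω) (hfin : HasFinPer Ω) :
    α * Eenergy lam δ (α⁻¹ • Ω) - Eenergy lam δ Ω
      ≤ lam * Real.log α / |Real.log δ| * perim Ω := by
  have hα0 : 0 < α := one_pos.trans hα
  have h1 := mul_perim_inv_smul_le hα0 hmeas hfin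
  have h2 := mul_nlE_inv_smul hα0 δ Ω
  have h3 := nlE_sub_nlE_le hδ0 (le_mul_of_one_le_left hδ0.le hα.le) hmeas hfin
  rw [mul_div_cancel_right₀ _ hδ0.ne'] at h3
  have hL : 0 < |Real.log δ| := abs_pos.2 (Real.log_neg hδ0 (by linarith)).ne
  have hc : 0 ≤ lam / (4 * |Real.log δ|) := by positivity
  have e : lam * Real.log α / |Real.log δ| * perim Ω
      = lam / (4 * |Real.log δ|) * (4 * Real.log α * perim Ω) := by
    field_simp
  rw [e]
  unfold Eenergy
  linear_combination h1 + lam / (4 * |Real.log δ|) * h3 - lam / (4 * |Real.log δ|) * h2
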